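/- Let k ≥ 2, let (r_n) be the all-one pattern sequence over F_2 (p = 2, a = 2^k − 1), and let R = Σ_{i≥1} r_{i−1} x^{-i} ∈ F_2((x^{-1})). R is irrational, so its continued fraction expansion with partial quotients A_j ∈ F_2[x] is well defined via A_0 = Pol(R), B_0 = R − A_0, A_{j+1} = Pol(B_j^{-1}), B_{j+1} = B_j^{-1} − A_{j+1}. Then A_1 = x^{2^k} + x, and for every j ≥ 1, A_{2j} = x^{2^k − 2} + x^{2^k − 4} + … + x^2 + 1 and A_{2j+1} = x^{2^k} + 1. -/

import Mathlib

noncomputable section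

/-- The element `x` of `F₂((x⁻¹))`: the field of formal Laurent series in `x⁻¹` is modelled
as `LaurentSeries (ZMod 2)` whose variable represents `x⁻¹`, so `x` is its inverse.
The coefficient of `x^{-i}` of an element `R` is then `R.coeff i`. -/
def xVar : LaurentSeries (ZMod 2) :=
  ((PowerSeries.X : PowerSeries (ZMod 2)) : LaurentSeries (ZMod 2))⁻¹

/-- The embedding of `F₂[x]` into `F₂((x⁻¹))`. -/
def polyToLaurent (P : Polynomial (ZMod 2)) : LaurentSeries (ZMod 2) :=
  Polynomial.aeval xVar P

/-- The polynomial part `Pol(R) ∈ F₂[x]` of `R = ∑_{i ≥ -m} r_i x^{-i}`, i.e.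
`∑_{i = -m}^{0} r_i x^{-i}`, viewed as a polynomial in `x`. -/
def polPart (R : LaurentSeries (ZMod 2)) : Polynomial (ZMod 2) :=
  ∑ j ∈ Finset.range ((-R.order).toNat + 1),
    Polynomial.C (R.coeff (-(j : ℤ))) * Polynomial.X ^ j

/-- The remainders in the continued fraction algorithm:
`B₀ = R - Pol(R)`, `B_{j+1} = B_j⁻¹ - Pol(B_j⁻¹)`. -/
def cfB (R : LaurentSeries (ZMod 2)) : ℕ → LaurentSeries (ZMod 2)
  | 0 => R - polyToLaurent (polPart R)
  | j + 1 => (cfB R j)⁻¹ - polyToLaurent (polPart ((cfB R j)⁻¹))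

/-- The partial quotients of the continued fraction expansion:
`A₀ = Pol(R)`, `A_{j+1} = Pol(B_j⁻¹)`. -/
def cfA (R : LaurentSeries (ZMod 2)) : ℕ → Polynomial (ZMod 2)
  | 0 => polPart R
  | j + 1 => polPart ((cfB R j)⁻¹)

open HahnSeries in
theorem coeff_polyToLaurent (P : Polynomial (ZMod 2)) (n : ℕ) :
    (polyToLaurent P).coeff (-(n : ℤ)) = P.coeff n := by
  have hx : xVar = single (-1 : ℤ) (1 : ZMod 2) := by
    simp [xVar, ofPowerSeries_X]
  have hC : ∀ c : ZMod 2, algebraMap (ZMod 2) (LaurentSeries (ZMod 2)) c = single 0 c := by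
    intro c
    exact ofPowerSeries_C c
  induction P using Polynomial.induction_on' with
  | add p q hp hq => simp only [polyToLaurent, map_add] at *; simp [hp, hq]
  | monomial m c =>
    rw [polyToLaurent, Polynomial.aeval_monomial, hx, hC, single_pow, single_mul_single,
      coeff_single, Polynomial.coeff_monomial]
    simp [eq_comm]

theorem coeff_polPart (R : LaurentSeries (ZMod 2)) (n : ℕ) :
    (polPart R).coeff n = R.coeff (-(n : ℤ)) := by
  simp only [polPart, Polynomial.finsetSum_coeff, Polynomial.coeff_C_mul, Polynomial.coeff_X_pow]
  simp only [mul_ite, mul_one, mul_zero, Finset.sum_ite_eq, Finset.mem_range]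
  split_ifs with h
  · rfl
  · exact (HahnSeries.coeff_eq_zero_of_lt_order (by omega)).symm

/-- A polynomial plus a series with only negative powers of `x` has the former as its
polynomial part. -/
theorem polPart_polyToLaurent_add (P : Polynomial (ZMod 2)) (F : PowerSeries (ZMod 2)) :
    polPart (polyToLaurent P + ((PowerSeries.X * F : PowerSeries (ZMod 2)) :
      LaurentSeries (ZMod 2))) = P := by
  ext n
  rw [coeff_polPart, HahnSeries.coeff_add, coeff_polyToLaurent, PowerSeries.coeff_coe]
  rcases Nat.eq_zero_or_pos n with rfl | hn
  · simp
  · rw [if_pos (by omega), add_zero]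

theorem polyToLaurent_injective : Function.Injective polyToLaurent := fun P Q h => by
  ext n
  rw [← coeff_polyToLaurent, h, coeff_polyToLaurent]

theorem cf_step {R : LaurentSeries (ZMod 2)} {j : ℕ} {P : Polynomial (ZMod 2)}
    {F : PowerSeries (ZMod 2)}
    (h : (cfB R j)⁻¹ = polyToLaurent P +
      ((PowerSeries.X * F : PowerSeries (ZMod 2)) : LaurentSeries (ZMod 2))) :
    cfA R (j + 1) = P ∧
      cfB R (j + 1) = ((PowerSeries.X * F : PowerSeries (ZMod 2)) : LaurentSeries (ZMod 2)) := by
  rw [cfA, cfB, h, polPart_polyToLaurent_add]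
  simp

/-- If `q` is even, the quadratic equation `y^(q+1) f² + y^q f g + g² = 0` has no solution with
`g ≠ 0` when `y` is prime. -/
theorem quadratic_ne_zero_of_prime {A : Type*} [CommRing A] [IsDomain A] [WfDvdMonoid A]
    {y : A} (hy : Prime y) {q : ℕ} (hq : Even q) (hq0 : 0 < q) {f g : A} (hg : g ≠ 0) :
    y ^ (q + 1) * f ^ 2 + y ^ q * f * g + g ^ 2 ≠ 0 := by
  intro h
  obtain ⟨s, rfl⟩ := hq
  have hf : f ≠ 0 := by
    rintro rfl
    simp [hg] at h
  obtain ⟨f', hfe, hf'⟩ := (FiniteMultiplicity.of_prime_left hy hf).exists_eq_pow_mul_and_not_dvd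
  obtain ⟨g', hge, hg'⟩ := (FiniteMultiplicity.of_prime_left hy hg).exists_eq_pow_mul_and_not_dvd
  generalize multiplicity y f = a at hfe
  generalize multiplicity y g = b at hge
  subst hfe hge
  rcases le_or_gt b (a + s) with hb | hb
  · obtain ⟨c, hc⟩ := Nat.exists_eq_add_of_le hb
    obtain ⟨t, rfl⟩ : ∃ t, s = t + 1 := ⟨s - 1, by omega⟩
    have e : (y ^ b) ^ 2 * (y * (y ^ (2 * c) * f' ^ 2 + y ^ (c + t) * f' * g') + g' ^ 2) = 0 := by
      rw [← h]
      have e1 : y ^ (t + 1 + (t + 1) + 1) * (y ^ a * f') ^ 2 =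
          y * (y ^ (a + (t + 1))) ^ 2 * f' ^ 2 := by ring
      have e2 : y ^ (t + 1 + (t + 1)) * (y ^ a * f') * (y ^ b * g') =
          y ^ (a + (t + 1)) * y ^ (t + 1) * f' * y ^ b * g' := by ring
      rw [e1, e2, hc]
      ring
    have e' := (mul_eq_zero.mp e).resolve_left (pow_ne_zero _ (pow_ne_zero _ hy.ne_zero))
    exact hg' (hy.dvd_of_dvd_pow (n := 2)
      ((dvd_add_right (dvd_mul_right y _)).mp (e' ▸ dvd_zero y)))
  · obtain ⟨c, rfl⟩ := Nat.exists_eq_add_of_lt hb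
    obtain ⟨t, rfl⟩ : ∃ t, s = t + 1 := ⟨s - 1, by omega⟩
    have e : y ^ (2 * (t + 1) + 1 + 2 * a) *
        (f' ^ 2 + y * (y ^ (t + c) * f' * g' + y ^ (2 * c) * g' ^ 2)) = 0 := by
      rw [← h]
      ring
    have e' := (mul_eq_zero.mp e).resolve_left (pow_ne_zero _ hy.ne_zero)
    exact hf' (hy.dvd_of_dvd_pow (n := 2)
      ((dvd_add_left (dvd_mul_right y _)).mp (e' ▸ dvd_zero y)))

theorem coeff_sq_zmod_two (F : PowerSeries (ZMod 2)) (n : ℕ) :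
    PowerSeries.coeff n (F ^ 2) = if 2 ∣ n then PowerSeries.coeff (n / 2) F else 0 := by
  have h := MvPowerSeries.map_frobenius_expand (R := ZMod 2) 2 two_ne_zero (f := F)
  rw [ZMod.frobenius_zmod, MvPowerSeries.map_id] at h
  rw [← PowerSeries.coeff_expand 2 two_ne_zero]
  exact congrArg (PowerSeries.coeff n) h.symm

section AllOnePattern

variable {q : ℕ} {r : ℕ → ZMod 2}

/-- The generating function of the all-one pattern sequence satisfies a quadratic equation. -/
theorem pattern_functional_equation (hq2 : 2 ≤ q) (hr0 : r 0 = 0)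
    (hrec : ∀ n, 1 ≤ n → r n = r (n / 2) + if n % q = q - 1 then 1 else 0) :
    (1 + PowerSeries.X ^ q) * (PowerSeries.mk r + (1 + PowerSeries.X) * PowerSeries.mk r ^ 2) =
      (PowerSeries.X ^ (q - 1) : PowerSeries (ZMod 2)) := by
  have h2 : (2 : ZMod 2) = 0 := rfl
  have hsq : PowerSeries.mk r + (1 + PowerSeries.X) * PowerSeries.mk r ^ 2 =
      PowerSeries.mk fun n => if n % q = q - 1 then 1 else 0 := by
    ext n
    rw [add_mul, one_mul, map_add, map_add, coeff_sq_zmod_two]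
    rcases n with _ | n
    · have : ¬ 0 = q - 1 := by omega
      simp [hr0, this]
    · rw [PowerSeries.coeff_succ_X_mul, coeff_sq_zmod_two]
      simp only [PowerSeries.coeff_mk]
      rw [hrec (n + 1) (by omega)]
      rcases Nat.even_or_odd' n with ⟨m, rfl | rfl⟩
      · have hodd : ¬ 2 ∣ 2 * m + 1 := by omega
        rw [if_neg hodd, if_pos (dvd_mul_right 2 m), show (2 * m + 1) / 2 = 2 * m / 2 by omega]
        linear_combination r (2 * m / 2) * h2
      · have heven : 2 ∣ 2 * m + 1 + 1 := by omega
        have hodd : ¬ 2 ∣ 2 * m + 1 := by omega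
        rw [if_pos heven, if_neg hodd]
        linear_combination r ((2 * m + 1 + 1) / 2) * h2
  rw [hsq]
  ext n
  rw [add_mul, one_mul, map_add, PowerSeries.coeff_X_pow_mul', PowerSeries.coeff_X_pow]
  simp only [PowerSeries.coeff_mk]
  rcases le_or_gt q n with hqn | hqn
  · have hne : n ≠ q - 1 := by omega
    rw [if_pos hqn, if_neg hne, ← Nat.mod_eq_sub_mod hqn, CharTwo.add_self_eq_zero]
  · rw [if_neg hqn.not_ge, Nat.mod_eq_of_lt hqn, add_zero]

theorem pattern_eq_zero_of_lt (hr0 : r 0 = 0)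
    (hrec : ∀ n, 1 ≤ n → r n = r (n / 2) + if n % q = q - 1 then 1 else 0)
    (n : ℕ) (hn : n < q - 1) : r n = 0 := by
  induction n using Nat.strong_induction_on with
  | _ n ih =>
    rcases Nat.eq_zero_or_pos n with rfl | h
    · exact hr0
    · rw [hrec n h, ih _ (by omega) (by omega), Nat.mod_eq_of_lt (by omega), if_neg (by omega),
        add_zero]

end AllOnePattern

theorem sum_X_pow_even_eq (k : ℕ) (hk : 1 ≤ k) :
    ∑ i ∈ Finset.range (2 ^ (k - 1)), (Polynomial.X : Polynomial (ZMod 2)) ^ (2 * i) =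
      (Polynomial.X + 1) ^ (2 ^ k - 2) := by
  obtain ⟨k, rfl⟩ := Nat.exists_eq_add_of_le' hk
  have hX : (Polynomial.X + 1 : Polynomial (ZMod 2)) ≠ 0 := Polynomial.X_add_C_ne_zero 1
  have hpow : 2 ≤ 2 ^ (k + 1) := Nat.le_self_pow (by omega) 2
  apply mul_right_cancel₀ (pow_ne_zero 2 hX)
  rw [← pow_add, Nat.sub_add_cancel hpow, add_pow_char_pow, add_pow_char]
  simp only [pow_mul, one_pow, Nat.add_sub_cancel, ← CharTwo.sub_eq_add]
  rw [geom_sum_mul, ← pow_mul, pow_succ' 2 k]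

/-- For the all-one pattern sequence `r` (pattern `11⋯1` of length `k ≥ 2`), the Laurent
series `R = ∑_{i ≥ 1} r_{i-1} x^{-i}` is irrational, and its continued fraction expansion
has partial quotients `A₁ = x^(2^k) + x`, and for all `j ≥ 1`,
`A_{2j} = x^(2^k - 2) + x^(2^k - 4) + ⋯ + x² + 1` and `A_{2j+1} = x^(2^k) + 1`. -/
theorem allOnePattern_continuedFraction (k : ℕ) (hk : 2 ≤ k)
    (r : ℕ → ZMod 2) (hr0 : r 0 = 0)
    (hrec : ∀ n, 1 ≤ n → r n = r (n / 2) + if n % 2 ^ k = 2 ^ k - 1 then 1 else 0)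
    (R : LaurentSeries (ZMod 2))
    (hR : R = ((PowerSeries.X * PowerSeries.mk r : PowerSeries (ZMod 2)) :
      LaurentSeries (ZMod 2))) :
    (¬ ∃ f g : Polynomial (ZMod 2), g ≠ 0 ∧ polyToLaurent g * R = polyToLaurent f) ∧
    cfA R 1 = Polynomial.X ^ 2 ^ k + Polynomial.X ∧
    ∀ j, 1 ≤ j →
      cfA R (2 * j) = ∑ i ∈ Finset.range (2 ^ (k - 1)), Polynomial.X ^ (2 * i) ∧
      cfA R (2 * j + 1) = Polynomial.X ^ 2 ^ k + 1 := by
  have hYpow : (Polynomial.X + 1 : Polynomial (ZMod 2)) ^ 2 ^ k = Polynomial.X ^ 2 ^ k + 1 := by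
    rw [add_pow_char_pow, one_pow]
  rw [sum_X_pow_even_eq k (by omega), ← hYpow]
  have hXq : (Polynomial.X : Polynomial (ZMod 2)) ^ 2 ^ k + Polynomial.X =
      (Polynomial.X + 1) ^ 2 ^ k + (Polynomial.X + 1) := by
    rw [hYpow]
    linear_combination -(CharTwo.two_eq_zero : (2 : Polynomial (ZMod 2)) = 0)
  rw [hXq]
  have hq4 : 4 ≤ 2 ^ k := by simpa using Nat.pow_le_pow_right (n := 2) (by omega) hk
  have hqe : Even (2 ^ k) := (Nat.even_pow' (by omega)).mpr even_two
  have hfun := pattern_functional_equation (by omega) hr0 hrec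
  have hdvd : (PowerSeries.X : PowerSeries (ZMod 2)) ^ (2 ^ k - 1) ∣ PowerSeries.mk r :=
    PowerSeries.X_pow_dvd_iff.mpr fun n hn => by
      rw [PowerSeries.coeff_mk, pattern_eq_zero_of_lt hr0 hrec n hn]
  clear hXq hr0 hrec
  obtain ⟨G, hG⟩ := hdvd
  generalize 2 ^ k = q at *
  obtain ⟨m, rfl⟩ := Nat.exists_eq_add_of_le' hq4
  set ι := HahnSeries.ofPowerSeries ℤ (ZMod 2) with hι
  set pl : Polynomial (ZMod 2) →ₐ[ZMod 2] LaurentSeries (ZMod 2) := Polynomial.aeval xVar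
  have hpl : ∀ P, polyToLaurent P = pl P := fun _ => rfl
  have h2 : (2 : LaurentSeries (ZMod 2)) = 0 := by
    rw [← map_ofNat (algebraMap (ZMod 2) (LaurentSeries (ZMod 2))) 2,
      show (OfNat.ofNat 2 : ZMod 2) = 0 from rfl, map_zero]
  have hX0 : ι PowerSeries.X ≠ 0 := by simp [hι]
  have hxX : xVar * ι PowerSeries.X = 1 := inv_mul_cancel₀ hX0
  have hplX : pl Polynomial.X = xVar := Polynomial.aeval_X _
  set y := pl (Polynomial.X + 1) with hy
  have hyx : y = xVar + 1 := by rw [hy, map_add, map_one, hplX]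
  have hyX : y * ι PowerSeries.X = 1 + ι PowerSeries.X := by
    rw [hyx, add_mul, hxX, one_mul]
  have hyXpow : y ^ (m + 4) * ι PowerSeries.X ^ (m + 4) = 1 + ι PowerSeries.X ^ (m + 4) := by
    rw [hy, ← map_pow, hYpow, map_add, map_one, map_pow, hplX, add_mul, ← mul_pow, hxX, one_pow,
      one_mul]
  have hE : y ^ (m + 4) * R = y ^ (m + 5) * R ^ 2 + 1 := by
    apply mul_left_cancel₀ (pow_ne_zero (m + 3) hX0)
    have hfun' := congrArg ι hfun
    simp only [map_mul, map_add, map_one, map_pow] at hfun'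
    rw [hR, map_mul]
    set T := ι PowerSeries.X
    set S := ι (PowerSeries.mk r)
    rw [show m + 4 - 1 = m + 3 by omega] at hfun'
    linear_combination hfun' + (S - y * T * S ^ 2) * hyXpow - (1 + T ^ (m + 4)) * S ^ 2 * hyX
      - (1 + T ^ (m + 4)) * (1 + T) * S ^ 2 * h2
  have hsmall1 : y ^ (m + 6) * R ^ 2 =
      ι (PowerSeries.X * (PowerSeries.X ^ (m + 1) * (1 + PowerSeries.X) ^ (m + 6) * G ^ 2)) := by
    rw [hR, hG, show m + 4 - 1 = m + 3 by omega]
    simp only [map_mul, map_add, map_one, map_pow]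
    rw [← hyX]
    ring
  have hsmall2 : y ^ (m + 4) * R ^ 2 =
      ι (PowerSeries.X * (PowerSeries.X ^ (m + 3) * (1 + PowerSeries.X) ^ (m + 4) * G ^ 2)) := by
    rw [hR, hG, show m + 4 - 1 = m + 3 by omega]
    simp only [map_mul, map_add, map_one, map_pow]
    rw [← hyX]
    ring
  have hB0 : cfB R 0 = R := by
    have h0 : polPart R = 0 := by
      have h := polPart_polyToLaurent_add 0 (PowerSeries.mk r)
      rwa [hpl, map_zero, zero_add, ← hι, ← hR] at h
    rw [cfB, h0, hpl, map_zero, sub_zero]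
  have step0 : (cfB R 0)⁻¹ = polyToLaurent ((Polynomial.X + 1) ^ (m + 4) + (Polynomial.X + 1)) +
      y ^ (m + 6) * R ^ 2 := by
    rw [hB0, hpl, map_add, map_pow, ← hy]
    apply inv_eq_of_mul_eq_one_right
    linear_combination (1 + y * R) * hE + (y ^ (m + 6) * R ^ 3 + y * R) * h2
  have hsq : y ^ (2 * m + 8) * R ^ 2 + y ^ (2 * m + 10) * R ^ 4 = 1 := by
    linear_combination (y ^ (m + 4) * R + y ^ (m + 5) * R ^ 2 + 1) * hE +
      y ^ (m + 5) * R ^ 2 * (1 + y ^ (m + 5) * R ^ 2) * h2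
  have step1 : (y ^ (m + 6) * R ^ 2)⁻¹ = polyToLaurent ((Polynomial.X + 1) ^ (m + 4 - 2)) +
      y ^ (m + 4) * R ^ 2 := by
    rw [hpl, map_pow, ← hy, show m + 4 - 2 = m + 2 by omega]
    apply inv_eq_of_mul_eq_one_right
    linear_combination hsq
  have step2 : (y ^ (m + 4) * R ^ 2)⁻¹ = polyToLaurent ((Polynomial.X + 1) ^ (m + 4)) +
      y ^ (m + 6) * R ^ 2 := by
    rw [hpl, map_pow, ← hy]
    apply inv_eq_of_mul_eq_one_right
    linear_combination hsq
  have odd_small : ∀ j, cfB R (2 * j + 1) = y ^ (m + 6) * R ^ 2 := by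
    intro j
    induction j with
    | zero => rw [hsmall1]; exact (cf_step (hsmall1 ▸ step0)).2
    | succ j ih =>
      have h1 : cfB R (2 * j + 2) = y ^ (m + 4) * R ^ 2 := by
        rw [← ih, hsmall2] at step1
        rw [hsmall2]
        exact (cf_step step1).2
      rw [← h1, hsmall1] at step2
      rw [hsmall1]
      exact (cf_step step2).2
  have even_step : ∀ j, cfA R (2 * j + 2) = (Polynomial.X + 1) ^ (m + 4 - 2) ∧
      cfB R (2 * j + 2) = y ^ (m + 4) * R ^ 2 := by
    intro j
    rw [← odd_small j, hsmall2] at step1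
    rw [hsmall2]
    exact cf_step step1
  refine ⟨?_, (cf_step (hsmall1 ▸ step0)).1, ?_⟩
  · rintro ⟨f, g, hg, hfg⟩
    have hprime : Prime (Polynomial.X + 1 : Polynomial (ZMod 2)) := by
      simpa [CharTwo.sub_eq_add] using Polynomial.prime_X_sub_C (1 : ZMod 2)
    apply quadratic_ne_zero_of_prime hprime hqe (by omega) (f := f) hg
    apply polyToLaurent_injective
    rw [hpl, hpl] at hfg
    rw [hpl, hpl, map_zero, map_add, map_add, map_mul, map_mul, map_mul, map_pow, map_pow, map_pow,
      map_pow, ← hy, ← hfg]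
    linear_combination (pl g) ^ 2 * (hE + (y ^ (m + 5) * R ^ 2 + 1) * h2)
  · intro j hj
    obtain ⟨j, rfl⟩ := Nat.exists_eq_add_of_le' hj
    obtain ⟨hA, hB⟩ := even_step j
    refine ⟨hA, ?_⟩
    rw [← hB, hsmall1] at step2
    exact (cf_step step2).1
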